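/- arXiv:2503.10570 — 3 statements merged into one kernel-verified Lean document; each statement's English description precedes it below -/
import Mathlib

section
/- Let H be a finite-dimensional complex inner product space, q ∈ B(H) an idempotent, k ≥ 0 a natural number, and A₁, …, A_{2k+1} ∈ B(H) operators each tangent at q (qAⱼ + Aⱼq = Aⱼ for all j). Then Tr(A₁ A₂ ⋯ A_{2k+1}) = 0. -/
/-- An element anticommuting with every entry of a list commutes with the product of the list up
to the sign `(-1) ^ l.length`. -/
theorem mul_list_prod_of_anticommute {R : Type*} [Ring R] (s : R) (l : List R)
    (h : ∀ a ∈ l, s * a = -(a * s)) : s * l.prod = (-1) ^ l.length * (l.prod * s) := by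
  induction l with
  | nil => simp
  | cons a l ih =>
    have ih' := ih fun b hb => h b (List.mem_cons_of_mem a hb)
    have hc : Commute a ((-1) ^ l.length) := (Commute.neg_one_right a).pow_right _
    rw [List.prod_cons, ← mul_assoc, h a List.mem_cons_self, neg_mul, mul_assoc, ih',
      ← mul_assoc a, hc.eq, List.length_cons, pow_succ]
    simp only [mul_assoc, neg_mul, one_mul, mul_neg]

/-- An operator anticommuting with an involution has trace zero. -/
theorem trace_eq_zero_of_anticommute_involution {K V : Type*} [Field K] [CharZero K]
    [AddCommGroup V] [Module K V] (s P : V →ₗ[K] V) (hs : s * s = 1)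
    (h : s * P = -(P * s)) : LinearMap.trace K V P = 0 := by
  have key : LinearMap.trace K V P = -LinearMap.trace K V P :=
    calc LinearMap.trace K V P = LinearMap.trace K V (s * (s * P)) := by
          rw [← mul_assoc, hs, one_mul]
      _ = LinearMap.trace K V (s * P * s) := LinearMap.trace_mul_comm K s (s * P)
      _ = -LinearMap.trace K V P := by
          rw [h, neg_mul, mul_assoc, hs, mul_one, map_neg]
  exact self_eq_neg.mp key

/-- For an idempotent `q` and an odd number of operators
`A₁, …, A_{2k+1}` each tangent at `q` (`qAⱼ + Aⱼq = Aⱼ`), the trace of their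
ordered product vanishes: `Tr(A₁ A₂ ⋯ A_{2k+1}) = 0`. -/
theorem stmt6 {H : Type} [NormedAddCommGroup H] [InnerProductSpace ℂ H]
    [FiniteDimensional ℂ H] (q : H →ₗ[ℂ] H) (hq : q * q = q)
    (k : ℕ) (A : Fin (2 * k + 1) → (H →ₗ[ℂ] H))
    (hA : ∀ j, q * A j + A j * q = A j) :
    LinearMap.trace ℂ H (List.ofFn A).prod = 0 := by
  have hs : (1 - 2 * q) * (1 - 2 * q) = 1 := by
    calc (1 - 2 * q) * (1 - 2 * q) = 1 + 4 * (q * q - q) := by noncomm_ring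
      _ = 1 := by rw [hq, sub_self, mul_zero, add_zero]
  refine trace_eq_zero_of_anticommute_involution (1 - 2 * q) _ hs ?_
  rw [mul_list_prod_of_anticommute, List.length_ofFn, pow_succ, pow_mul]
  · simp
  · intro a ha
    obtain ⟨j, rfl⟩ := (List.mem_ofFn' A a).mp ha
    rw [← sub_eq_zero]
    calc (1 - 2 * q) * A j - -(A j * (1 - 2 * q))
        = 2 * (A j - (q * A j + A j * q)) := by noncomm_ring
      _ = 0 := by rw [hA j, sub_self, mul_zero]
end

section
/- Let H be a finite-dimensional complex inner product space, p and q rank-1 Hermitian projections on H, and A ∈ B(H) an operator with qA = A and Aq = 0. If pq ≠ 0 and pA − Tr(pA)·p = 0, then A = 0. If pq = 0, then pA − Tr(pA)·p = 0 for every such A. (Thus the section S(q,p) : A ↦ pA − Tr(pA)p is injective when pq ≠ 0 and zero when pq = 0.) -/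
/-- If `q` has rank one, `A = qA` and `pq ≠ 0`, then `pA = 0` forces `A = 0`. -/
theorem eq_zero_of_mul_eq_zero_of_finrank_range_eq_one {K V : Type*} [Field K]
    [AddCommGroup V] [Module K V] {p q A : V →ₗ[K] V}
    (hqn : Module.finrank K (LinearMap.range q) = 1)
    (hqA : q * A = A) (hpq : p * q ≠ 0) (hpA : p * A = 0) : A = 0 := by
  obtain ⟨⟨v, _⟩, _, hv⟩ := finrank_eq_one_iff'.mp hqn
  have hspan (x : V) : ∃ c : K, c • v = q x := by
    obtain ⟨c, hc⟩ := hv ⟨q x, LinearMap.mem_range_self q x⟩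
    exact ⟨c, congrArg Subtype.val hc⟩
  have hpv : p v ≠ 0 := by
    intro hpv
    refine hpq (LinearMap.ext fun x => ?_)
    obtain ⟨c, hc⟩ := hspan x
    rw [Module.End.mul_apply, ← hc, map_smul, hpv, smul_zero, LinearMap.zero_apply]
  ext x
  obtain ⟨c, hc⟩ := hspan (A x)
  have hAx : c • v = A x := hc.trans (LinearMap.congr_fun hqA x)
  have hpAx : c • p v = 0 := by
    rw [← map_smul, hAx]
    exact LinearMap.congr_fun hpA x
  rw [← hAx, (smul_eq_zero.mp hpAx).resolve_right hpv, zero_smul, LinearMap.zero_apply]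

/-- Let `p, q` be rank-1 Hermitian projections and `A` an
operator with `qA = A`, `Aq = 0`. If `pq ≠ 0` and `pA − Tr(pA)·p = 0` then
`A = 0`; if `pq = 0` then `pA − Tr(pA)·p = 0` for every such `A`. (So the
section `S(q,p) : A ↦ pA − Tr(pA)p` is injective when `pq ≠ 0` and zero when
`pq = 0`.) -/
theorem stmt15 {H : Type} [NormedAddCommGroup H] [InnerProductSpace ℂ H]
    [FiniteDimensional ℂ H] (p q : H →ₗ[ℂ] H)
    (hp : p * p = p) (hp' : LinearMap.adjoint p = p)
    (hpn : Module.finrank ℂ (LinearMap.range p) = 1)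
    (hq : q * q = q) (hq' : LinearMap.adjoint q = q)
    (hqn : Module.finrank ℂ (LinearMap.range q) = 1) :
    (∀ A : H →ₗ[ℂ] H, q * A = A → A * q = 0 → p * q ≠ 0 →
      p * A - (LinearMap.trace ℂ H (p * A)) • p = 0 → A = 0) ∧
    (∀ A : H →ₗ[ℂ] H, q * A = A → A * q = 0 → p * q = 0 →
      p * A - (LinearMap.trace ℂ H (p * A)) • p = 0) := by
  refine ⟨fun A hqA hAq hpq h => ?_, fun A hqA _ hpq => ?_⟩
  · have hpA : p * A = LinearMap.trace ℂ H (p * A) • p := sub_eq_zero.mp h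
    have htrace : LinearMap.trace ℂ H (p * A) = 0 := by
      have hpAq : LinearMap.trace ℂ H (p * A) • (p * q) = 0 := by
        rw [← smul_mul_assoc, ← hpA, mul_assoc, hAq, mul_zero]
      exact (smul_eq_zero.mp hpAq).resolve_right hpq
    rw [htrace, zero_smul] at hpA
    exact eq_zero_of_mul_eq_zero_of_finrank_range_eq_one hqn hqA hpq hpA
  · have hpA : p * A = 0 := by rw [← hqA, ← mul_assoc, hpq, zero_mul]
    rw [hpA, map_zero, zero_smul, sub_zero]
end

section
/- Let H be a finite-dimensional complex inner product space, q ∈ B(H) a nonzero operator with Hilbert–Schmidt norm ‖q‖ = √(Tr(q*q)), and A ∈ B(H) a nonzero operator. Then Re[(2/‖q‖)·Tr(A*A) − (1/‖q‖³)·Tr(A*q)·Tr(Aq*)] > 0; that is, the bilinear form g(A,B) = Re[(2/‖q‖)·Tr(A*B) − (1/‖q‖³)·Tr(A*q)·Tr(Bq*)] is positive definite (it is the Riemannian metric with Kähler potential the Hilbert–Schmidt norm). -/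
/-- The values of an operator on the standard orthonormal basis; as a vector of `PiLp 2` this
realises the Hilbert–Schmidt inner product. -/
noncomputable def hilbertSchmidtVec {H : Type} [NormedAddCommGroup H] [InnerProductSpace ℂ H]
    [FiniteDimensional ℂ H] (X : H →ₗ[ℂ] H) :
    PiLp 2 (fun _ : Fin (Module.finrank ℂ H) => H) :=
  WithLp.toLp 2 fun i => X (stdOrthonormalBasis ℂ H i)

theorem inner_hilbertSchmidtVec {H : Type} [NormedAddCommGroup H] [InnerProductSpace ℂ H]
    [FiniteDimensional ℂ H] (X Y : H →ₗ[ℂ] H) :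
    inner ℂ (hilbertSchmidtVec X) (hilbertSchmidtVec Y) =
      LinearMap.trace ℂ H (LinearMap.adjoint X * Y) := by
  rw [LinearMap.trace_eq_sum_inner _ (stdOrthonormalBasis ℂ H)]
  simp [hilbertSchmidtVec, PiLp.inner_apply, LinearMap.adjoint_inner_right]

theorem hilbertSchmidtVec_ne_zero {H : Type} [NormedAddCommGroup H] [InnerProductSpace ℂ H]
    [FiniteDimensional ℂ H] {X : H →ₗ[ℂ] H} (hX : X ≠ 0) : hilbertSchmidtVec X ≠ 0 := by
  contrapose! hX
  refine (stdOrthonormalBasis ℂ H).toBasis.ext fun i => ?_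
  simpa [hilbertSchmidtVec] using congrArg (fun v => v i) hX

theorem re_inner_sub_inner_mul_inner_pos {E : Type*} [NormedAddCommGroup E]
    [InnerProductSpace ℂ E] {u v : E} (hu : u ≠ 0) (hv : v ≠ 0) :
    0 < ((2 / (‖u‖ : ℂ)) * inner ℂ v v
        - (1 / (‖u‖ : ℂ) ^ 3) * inner ℂ v u * inner ℂ u v).re := by
  have hu' : 0 < ‖u‖ := norm_pos_iff.2 hu
  have hv' : 0 < ‖v‖ := norm_pos_iff.2 hv
  have hcs : ‖inner ℂ v u‖ ^ 2 ≤ (‖v‖ * ‖u‖) ^ 2 := by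
    gcongr
    exact norm_inner_le_norm v u
  have hprod : inner ℂ v u * inner ℂ u v = ((‖inner ℂ v u‖ ^ 2 : ℝ) : ℂ) := by
    rw [← inner_conj_symm u v, Complex.mul_conj, Complex.normSq_eq_norm_sq]
  have hreal : (2 / (‖u‖ : ℂ)) * inner ℂ v v
        - (1 / (‖u‖ : ℂ) ^ 3) * inner ℂ v u * inner ℂ u v
      = ((2 / ‖u‖ * ‖v‖ ^ 2 - 1 / ‖u‖ ^ 3 * ‖inner ℂ v u‖ ^ 2 : ℝ) : ℂ) := by
    rw [mul_assoc, hprod, inner_self_eq_norm_sq_to_K]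
    push_cast
    rfl
  rw [hreal, Complex.ofReal_re]
  have hle : 1 / ‖u‖ ^ 3 * ‖inner ℂ v u‖ ^ 2 ≤ 1 / ‖u‖ * ‖v‖ ^ 2 :=
    calc 1 / ‖u‖ ^ 3 * ‖inner ℂ v u‖ ^ 2 ≤ 1 / ‖u‖ ^ 3 * (‖v‖ * ‖u‖) ^ 2 := by gcongr
      _ = 1 / ‖u‖ * ‖v‖ ^ 2 := by field_simp
  have hpos : 0 < 1 / ‖u‖ * ‖v‖ ^ 2 := by positivity
  have htwo : 2 / ‖u‖ * ‖v‖ ^ 2 = 2 * (1 / ‖u‖ * ‖v‖ ^ 2) := by ring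
  linarith


/-- For a nonzero operator `q` with Hilbert–Schmidt norm
`‖q‖ = √(Tr(q*q))` and any nonzero operator `A`,
`Re[(2/‖q‖)·Tr(A*A) − (1/‖q‖³)·Tr(A*q)·Tr(Aq*)] > 0`; i.e. the bilinear form
`g(A,B) = Re[(2/‖q‖)·Tr(A*B) − (1/‖q‖³)·Tr(A*q)·Tr(Bq*)]` is positive
definite. -/
theorem stmt19 {H : Type} [NormedAddCommGroup H] [InnerProductSpace ℂ H]
    [FiniteDimensional ℂ H] (q : H →ₗ[ℂ] H) (hq : q ≠ 0)
    (nq : ℝ)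
    (hnq : nq = Real.sqrt (LinearMap.trace ℂ H (LinearMap.adjoint q * q)).re)
    (A : H →ₗ[ℂ] H) (hA : A ≠ 0) :
    0 < ((2 / (nq : ℂ)) * LinearMap.trace ℂ H (LinearMap.adjoint A * A)
        - (1 / (nq : ℂ) ^ 3) * LinearMap.trace ℂ H (LinearMap.adjoint A * q)
            * LinearMap.trace ℂ H (A * LinearMap.adjoint q)).re := by
  have hnorm : nq = ‖hilbertSchmidtVec q‖ := by
    rw [hnq, ← inner_hilbertSchmidtVec]
    exact (norm_eq_sqrt_re_inner (𝕜 := ℂ) _).symm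
  have hcomm : LinearMap.trace ℂ H (A * LinearMap.adjoint q) =
      LinearMap.trace ℂ H (LinearMap.adjoint q * A) := LinearMap.trace_mul_comm ℂ _ _
  rw [hcomm, hnorm, ← inner_hilbertSchmidtVec, ← inner_hilbertSchmidtVec,
    ← inner_hilbertSchmidtVec]
  exact re_inner_sub_inner_mul_inner_pos (hilbertSchmidtVec_ne_zero hq)
    (hilbertSchmidtVec_ne_zero hA)
end
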